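/- Decisiveness implies strong decisiveness: let (S, Σ, κ) be a stochastic transition system and B ∈ Σ. If the STS is decisive with respect to B, then it is strongly decisive with respect to B; that is, for every initial distribution μ on S, P_μ(GF B ∪ F B̃) = 1 (almost every run either visits B infinitely often or reaches B̃). -/

import Mathlib

open MeasureTheory ProbabilityTheory Filter Set Topology

/-- Prepend one state to an infinite run. -/
def prep {S : Type*} (s : S) (ρ : ℕ → S) : ℕ → S
  | 0 => s
  | n + 1 => ρ n

/-- Prepend a finite word to an infinite run. -/
def prepList {S : Type*} (l : List S) (ρ : ℕ → S) : ℕ → S := fun n =>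
  if h : n < l.length then l.get ⟨n, h⟩ else ρ (n - l.length)

/-- `E` is a tail event: membership is not affected by changing a finite prefix. -/
def IsTailEvent {S : Type*} (E : Set (ℕ → S)) : Prop :=
  ∀ (l : List S) (ρ : ℕ → S), ρ ∈ E ↔ prepList l ρ ∈ E

/-- Cylinder `Cyl A n = {ρ | ρ k ∈ A k for all k < n}` (built from `A 0, …, A (n-1)`). -/
def Cyl {S : Type*} (A : ℕ → Set S) (n : ℕ) : Set (ℕ → S) := {ρ | ∀ k < n, ρ k ∈ A k}

/-- Event `F B`: eventually reach `B`. -/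
def FEv {S : Type*} (B : Set S) : Set (ℕ → S) := {ρ | ∃ n, ρ n ∈ B}

/-- Event `F^{≤ m} B`: reach `B` within `m` steps. -/
def FleEv {S : Type*} (m : ℕ) (B : Set S) : Set (ℕ → S) := {ρ | ∃ n ≤ m, ρ n ∈ B}

/-- Event `G B`: always in `B`. -/
def GEv {S : Type*} (B : Set S) : Set (ℕ → S) := {ρ | ∀ n, ρ n ∈ B}

/-- Event `GF B`: visit `B` infinitely often. -/
def GFEv {S : Type*} (B : Set S) : Set (ℕ → S) := {ρ | ∀ i, ∃ j ≥ i, ρ j ∈ B}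

/-- Event `FG B`: eventually always in `B`. -/
def FGEv {S : Type*} (B : Set S) : Set (ℕ → S) := {ρ | ∃ i, ∀ j ≥ i, ρ j ∈ B}

/-- Event `GF φ_𝒜`: the pattern `A 0, …, A n` occurs at infinitely many positions. -/
def GFPat {S : Type*} (A : ℕ → Set S) (n : ℕ) : Set (ℕ → S) :=
  {ρ | ∀ i, ∃ j ≥ i, ∀ k ≤ n, ρ (j + k) ∈ A k}

/-- Event `A U B`. -/
def UntilEv {S : Type*} (A B : Set S) : Set (ℕ → S) :=
  {ρ | ∃ n, ρ n ∈ B ∧ ∀ k < n, ρ k ∈ A}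

/-- Event `A U^{≤ m} B`. -/
def UntilLeEv {S : Type*} (m : ℕ) (A B : Set S) : Set (ℕ → S) :=
  {ρ | ∃ n ≤ m, ρ n ∈ B ∧ ∀ k < n, ρ k ∈ A}

/-- The filtration `F n`: σ-algebra generated by the cylinders of length `n`,
i.e., by the first `n` coordinates. -/
def cylFiltration (S : Type*) [MeasurableSpace S] (n : ℕ) : MeasurableSpace (ℕ → S) :=
  MeasurableSpace.comap (fun ρ (i : Fin n) => ρ i) inferInstance

/-- `P` is the family of path measures of the STS `(S, Σ, κ)` given by the
Ionescu–Tulcea construction: for every initial probability distribution `μ`,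
`P μ` is a probability measure on runs, and `P` satisfies the Markov property
(`s₀ ∼ μ`, and the rest of the run follows the chain started in `κ s₀`),
which uniquely characterizes the Ionescu–Tulcea path measures. -/
def IsPathMeasure {S : Type*} [MeasurableSpace S] (κ : Kernel S S)
    (P : Measure S → Measure (ℕ → S)) : Prop :=
  (∀ μ : Measure S, IsProbabilityMeasure μ → IsProbabilityMeasure (P μ)) ∧
  (∀ μ : Measure S, IsProbabilityMeasure μ →
    P μ = μ.bind fun s => (P (κ s)).map (prep s))

/-- `B̃`: the set of states from which `B` is reached with probability zero. -/
def Btilde {S : Type*} [MeasurableSpace S] (P : Measure S → Measure (ℕ → S)) (B : Set S) :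
    Set S := {s | P (Measure.dirac s) (FEv B) = 0}

/-- The STS with path measures `P` is decisive w.r.t. `B`. -/
def Decisive {S : Type*} [MeasurableSpace S] (P : Measure S → Measure (ℕ → S)) (B : Set S) :
    Prop := ∀ μ : Measure S, IsProbabilityMeasure μ → P μ (FEv B ∪ FEv (Btilde P B)) = 1

/-- `ν_{A₀,…,Aₙ}`: the distribution of the `n`-th state under `P ν` conditioned on
the cylinder `Cyl A (n+1)`. -/
noncomputable def condDist {S : Type*} [MeasurableSpace S]
    (P : Measure S → Measure (ℕ → S)) (ν : Measure S) (A : ℕ → Set S) (n : ℕ) : Measure S :=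
  (ProbabilityTheory.cond (P ν) (Cyl A (n + 1))).map fun ρ => ρ n

theorem measurable_prep {S : Type*} [MeasurableSpace S] (s : S) : Measurable (prep s) := by
  refine measurable_pi_iff.2 fun n => ?_
  cases n with
  | zero => exact measurable_const
  | succ n => exact measurable_pi_apply n

theorem measurableSet_FEv {S : Type*} [MeasurableSpace S] {B : Set S} (hB : MeasurableSet B) :
    MeasurableSet (FEv B) := by
  have h : FEv B = ⋃ n, (fun ρ : ℕ → S => ρ n) ⁻¹' B := by ext; simp [FEv]
  rw [h]
  exact MeasurableSet.iUnion fun n => measurable_pi_apply n hB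

theorem measurableSet_FleEv {S : Type*} [MeasurableSpace S] {B : Set S} (hB : MeasurableSet B)
    (m : ℕ) : MeasurableSet (FleEv m B) := by
  have h : FleEv m B = ⋃ n, ⋃ (_ : n ≤ m), (fun ρ : ℕ → S => ρ n) ⁻¹' B := by
    ext; simp [FleEv]
  rw [h]
  exact MeasurableSet.iUnion fun n => MeasurableSet.iUnion fun _ => measurable_pi_apply n hB

theorem prep_preimage_FleEv_of_mem {S : Type*} {B : Set S} {s : S} (hs : s ∈ B) (m : ℕ) :
    prep s ⁻¹' FleEv m B = univ :=
  eq_univ_of_forall fun _ => ⟨0, Nat.zero_le m, hs⟩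

theorem prep_preimage_FleEv_zero {S : Type*} {B : Set S} {s : S} (hs : s ∉ B) :
    prep s ⁻¹' FleEv 0 B = ∅ := by
  refine eq_empty_of_forall_notMem ?_
  rintro ρ ⟨n, hn, h⟩
  obtain rfl : n = 0 := Nat.le_zero.1 hn
  exact hs h

theorem prep_preimage_FleEv_succ {S : Type*} {B : Set S} {s : S} (hs : s ∉ B) (m : ℕ) :
    prep s ⁻¹' FleEv (m + 1) B = FleEv m B := by
  ext ρ
  constructor
  · rintro ⟨n, hn, h⟩
    cases n with
    | zero => exact absurd h hs
    | succ n => exact ⟨n, Nat.le_of_succ_le_succ hn, h⟩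
  · rintro ⟨n, hn, h⟩
    exact ⟨n + 1, Nat.succ_le_succ hn, h⟩

/-- One-step Markov property: disintegrate the probability of an event along the first state. -/
theorem IsPathMeasure.apply_eq_lintegral {S : Type*} [MeasurableSpace S] {κ : Kernel S S}
    {P : Measure S → Measure (ℕ → S)} (hP : IsPathMeasure κ P) (μ : Measure S)
    [IsProbabilityMeasure μ] {E : Set (ℕ → S)} (hE : MeasurableSet E) :
    P μ E = ∫⁻ s, P (κ s) (prep s ⁻¹' E) ∂μ := by
  have hprob : IsProbabilityMeasure (P μ) := hP.1 μ inferInstance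
  have heq := hP.2 μ inferInstance
  have hf : AEMeasurable (fun s => (P (κ s)).map (prep s)) μ := by
    by_contra hf
    have h0 : P μ = 0 := by
      rw [heq, Measure.bind, Measure.map_of_not_aemeasurable hf, Measure.join_zero]
    exact hprob.ne_zero _ h0
  rw [heq, Measure.bind_apply hE hf]
  exact lintegral_congr fun s => Measure.map_apply (measurable_prep s) hE

/-- Bounded reachability probabilities are integrals of a measurable function of the initial
state. -/
theorem IsPathMeasure.exists_measurable_FleEv {S : Type*} [MeasurableSpace S] {κ : Kernel S S}
    [IsMarkovKernel κ] {P : Measure S → Measure (ℕ → S)} (hP : IsPathMeasure κ P) {B : Set S}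
    (hB : MeasurableSet B) (m : ℕ) :
    ∃ u : S → ENNReal, Measurable u ∧
      ∀ μ : Measure S, IsProbabilityMeasure μ → P μ (FleEv m B) = ∫⁻ s, u s ∂μ := by
  classical
  have hone (s : S) : P (κ s) univ = 1 := (hP.1 (κ s) inferInstance).measure_univ
  induction m with
  | zero =>
    refine ⟨B.piecewise 1 0, measurable_one.piecewise hB measurable_zero, fun μ _ => ?_⟩
    rw [hP.apply_eq_lintegral μ (measurableSet_FleEv hB 0)]
    refine lintegral_congr fun s => ?_
    by_cases hs : s ∈ B
    · simp [hs, prep_preimage_FleEv_of_mem hs, hone]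
    · simp [hs, prep_preimage_FleEv_zero hs]
  | succ m ih =>
    obtain ⟨u, hu, hPu⟩ := ih
    refine ⟨B.piecewise 1 fun s => ∫⁻ t, u t ∂κ s,
      measurable_one.piecewise hB hu.lintegral_kernel, fun μ _ => ?_⟩
    rw [hP.apply_eq_lintegral μ (measurableSet_FleEv hB (m + 1))]
    refine lintegral_congr fun s => ?_
    by_cases hs : s ∈ B
    · simp [hs, prep_preimage_FleEv_of_mem hs, hone]
    · simp [hs, prep_preimage_FleEv_succ hs, hPu (κ s) inferInstance]

theorem IsPathMeasure.measurableSet_Btilde {S : Type*} [MeasurableSpace S] {κ : Kernel S S}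
    [IsMarkovKernel κ] {P : Measure S → Measure (ℕ → S)} (hP : IsPathMeasure κ P) {B : Set S}
    (hB : MeasurableSet B) : MeasurableSet (Btilde P B) := by
  choose u hu hPu using hP.exists_measurable_FleEv hB
  have hF : FEv B = ⋃ m, FleEv m B := by
    ext ρ
    simp only [FEv, FleEv, mem_ofPred_eq, mem_iUnion]
    exact ⟨fun ⟨n, h⟩ => ⟨n, n, le_rfl, h⟩, fun ⟨_, n, _, h⟩ => ⟨n, h⟩⟩
  have h : Btilde P B = ⋂ m, u m ⁻¹' {0} := by
    ext s
    simp only [Btilde, hF, mem_ofPred_eq, measure_iUnion_null_iff, mem_iInter, mem_preimage,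
      mem_singleton_iff, hPu _ _ Measure.dirac.isProbabilityMeasure, lintegral_dirac' s (hu _)]
  rw [h]
  exact MeasurableSet.iInter fun m => hu m (measurableSet_singleton 0)

/-- An event that is null from every initial distribution remains null after any time shift. -/
theorem IsPathMeasure.shift_null {S : Type*} [MeasurableSpace S] {κ : Kernel S S}
    [IsMarkovKernel κ] {P : Measure S → Measure (ℕ → S)} (hP : IsPathMeasure κ P)
    {D : Set (ℕ → S)} (hD : MeasurableSet D)
    (hnull : ∀ μ : Measure S, IsProbabilityMeasure μ → P μ D = 0) (n : ℕ) (μ : Measure S)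
    [IsProbabilityMeasure μ] : P μ {ρ | (fun k => ρ (k + n)) ∈ D} = 0 := by
  induction n generalizing μ with
  | zero => exact hnull μ inferInstance
  | succ n ih =>
    have hmeas : MeasurableSet {ρ : ℕ → S | (fun k => ρ (k + (n + 1))) ∈ D} :=
      (measurable_pi_iff.2 fun k => measurable_pi_apply (k + (n + 1))) hD
    rw [hP.apply_eq_lintegral μ hmeas]
    exact (lintegral_congr fun s => ih (κ s)).trans lintegral_zero

/-- **Decisiveness implies strong decisiveness.** If the STS is decisive w.r.t. `B`, then
for every initial distribution `μ`, almost every run either visits `B` infinitely often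
or reaches `B̃`: `P_μ(GF B ∪ F B̃) = 1`. -/
theorem decisive_implies_strongly_decisive
    {S : Type*} [MeasurableSpace S] (κ : Kernel S S) [IsMarkovKernel κ]
    (P : Measure S → Measure (ℕ → S)) (hP : IsPathMeasure κ P)
    (B : Set S) (hB : MeasurableSet B)
    (hdec : Decisive P B) :
    ∀ μ : Measure S, IsProbabilityMeasure μ →
      P μ (GFEv B ∪ FEv (Btilde P B)) = 1 := by
  intro μ hμ
  have hBt : MeasurableSet (Btilde P B) := hP.measurableSet_Btilde hB
  have hmeas : MeasurableSet (FEv B ∪ FEv (Btilde P B)) :=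
    (measurableSet_FEv hB).union (measurableSet_FEv hBt)
  have hnull (ν : Measure S) (hν : IsProbabilityMeasure ν) :
      P ν (FEv B ∪ FEv (Btilde P B))ᶜ = 0 := by
    have := hP.1 ν hν
    exact (prob_compl_eq_zero_iff hmeas).2 (hdec ν hν)
  have := hP.1 μ hμ
  have hshift : ∀ᵐ ρ ∂P μ, ∀ n, (fun k => ρ (k + n)) ∈ FEv B ∪ FEv (Btilde P B) :=
    ae_all_iff.2 fun n => hP.shift_null hmeas.compl hnull n μ
  have hae : ∀ᵐ ρ ∂P μ, ρ ∈ GFEv B ∪ FEv (Btilde P B) := by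
    filter_upwards [hshift] with ρ hρ
    by_cases hreach : ρ ∈ FEv (Btilde P B)
    · exact Or.inr hreach
    · refine Or.inl fun i => ?_
      rcases hρ i with ⟨k, hk⟩ | ⟨k, hk⟩
      · exact ⟨k + i, Nat.le_add_left i k, hk⟩
      · exact absurd ⟨k + i, hk⟩ hreach
  exact (measure_congr (eventuallyEq_univ.2 hae)).trans measure_univ
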